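/- arXiv:2304.08722 — 2 statements merged into one kernel-verified Lean document; each statement's English description precedes it below -/
import Mathlib

section
/- Let α = (α_1,…,α_r) and β = (β_1,…,β_m) be tuples of positive integers with α_r ≥ 2 and β_m ≥ 2 (when m ≥ 1). Then Σ_{k=0}^{m} (-1)^k · ζ(β_{k+1},…,β_m) · Z_U(α; (β_k, β_{k-1},…,β_1)) = ζ(α_1,…,α_r, β_1,…,β_m). -/
open scoped BigOperators

/-- Multiple zeta value `ζ(α₁,…,α_r) = Σ_{1 ≤ k₁ < ⋯ < k_r} k₁^{-α₁} ⋯ k_r^{-α_r}`;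
`mzv [] = 1`. -/
noncomputable def mzv (α : List ℕ) : ℝ :=
  ∑' f : {f : Fin α.length → ℕ+ // StrictMono f},
    ∏ i : Fin α.length, ((f.1 i : ℝ) ^ (α.get i))⁻¹

/-- Multiple zeta-star value `ζ⋆(α₁,…,α_r) = Σ_{1 ≤ k₁ ≤ ⋯ ≤ k_r} k₁^{-α₁} ⋯ k_r^{-α_r}`;
`mzvStar [] = 1`. -/
noncomputable def mzvStar (α : List ℕ) : ℝ :=
  ∑' f : {f : Fin α.length → ℕ+ // Monotone f},
    ∏ i : Fin α.length, ((f.1 i : ℝ) ^ (α.get i))⁻¹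

/-- `Z_U(α;β) = Σ_{1≤k₁<⋯<k_r} k₁^{-α₁}⋯k_r^{-α_r} Σ_{1≤ℓ₁≤⋯≤ℓ_m≤k_r} ℓ₁^{-β₁}⋯ℓ_m^{-β_m}`. -/
noncomputable def ZU (α β : List ℕ) : ℝ :=
  ∑' p : {p : (Fin α.length → ℕ+) × (Fin β.length → ℕ+) //
      StrictMono p.1 ∧ Monotone p.2 ∧
      ∀ j : Fin β.length, (j : ℕ) = β.length - 1 →
        ∀ i : Fin α.length, (i : ℕ) = α.length - 1 → p.2 j ≤ p.1 i},
    (∏ i : Fin α.length, ((p.1.1 i : ℝ) ^ (α.get i))⁻¹) *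
      ∏ j : Fin β.length, ((p.1.2 j : ℝ) ^ (β.get j))⁻¹

/-- `Z_L(α;β) = Σ_{1≤k₁<⋯<k_r} k₁^{-α₁}⋯k_r^{-α_r} Σ_{k₁≤ℓ₁≤⋯≤ℓ_m} ℓ₁^{-β₁}⋯ℓ_m^{-β_m}`. -/
noncomputable def ZL (α β : List ℕ) : ℝ :=
  ∑' p : {p : (Fin α.length → ℕ+) × (Fin β.length → ℕ+) //
      StrictMono p.1 ∧ Monotone p.2 ∧
      ∀ i : Fin α.length, (i : ℕ) = 0 →
        ∀ j : Fin β.length, (j : ℕ) = 0 → p.1 i ≤ p.2 j},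
    (∏ i : Fin α.length, ((p.1.1 i : ℝ) ^ (α.get i))⁻¹) *
      ∏ j : Fin β.length, ((p.1.2 j : ℝ) ^ (β.get j))⁻¹

/-- `Z_B(α;β) = Σ_{1≤k₁<⋯<k_r} k₁^{-α₁}⋯k_r^{-α_r} Σ_{k₁≤ℓ₁≤⋯≤ℓ_m≤k_r} ℓ₁^{-β₁}⋯ℓ_m^{-β_m}`. -/
noncomputable def ZB (α β : List ℕ) : ℝ :=
  ∑' p : {p : (Fin α.length → ℕ+) × (Fin β.length → ℕ+) //
      StrictMono p.1 ∧ Monotone p.2 ∧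
      (∀ i : Fin α.length, (i : ℕ) = 0 →
        ∀ j : Fin β.length, (j : ℕ) = 0 → p.1 i ≤ p.2 j) ∧
      ∀ j : Fin β.length, (j : ℕ) = β.length - 1 →
        ∀ i : Fin α.length, (i : ℕ) = α.length - 1 → p.2 j ≤ p.1 i},
    (∏ i : Fin α.length, ((p.1.1 i : ℝ) ^ (α.get i))⁻¹) *
      ∏ j : Fin β.length, ((p.1.2 j : ℝ) ^ (β.get j))⁻¹

open scoped ENNReal

namespace ChainSum

open Classical in
/-- The indicator of a proposition, as an extended nonnegative real. -/
noncomputable def ind (p : Prop) : ℝ≥0∞ := if p then 1 else 0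

theorem ind_and (p q : Prop) : ind (p ∧ q) = ind p * ind q := by
  by_cases hp : p <;> by_cases hq : q <;> simp [ind, hp, hq]

/-- The weight `k⁻ᵇ`. -/
noncomputable def weight (b : ℕ) (k : ℕ+) : ℝ≥0∞ := ((k : ℝ≥0∞) ^ b)⁻¹

theorem toReal_weight (b : ℕ) (k : ℕ+) : (weight b k).toReal = ((k : ℝ) ^ b)⁻¹ := by
  simp [weight, ENNReal.toReal_inv]

theorem weight_ne_top (b : ℕ) (k : ℕ+) : weight b k ≠ ∞ := by
  simp [weight]

theorem weight_le_weight {b c : ℕ} (h : b ≤ c) (k : ℕ+) : weight c k ≤ weight b k := by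
  unfold weight
  rw [ENNReal.inv_le_inv]
  exact pow_le_pow_right₀ (by exact_mod_cast k.pos) h

/-- The sum of `k₁^{-γ₁} ⋯ k_r^{-γ_r} F(k_r)` over all chains `m R k₁ R k₂ R ⋯ R k_r`. -/
noncomputable def chainSum (R : ℕ → ℕ → Prop) (F : ℕ → ℝ≥0∞) : ℕ → List ℕ → ℝ≥0∞
  | m, [] => F m
  | m, b :: γ => ∑' k : ℕ+, ind (R m k) * weight b k * chainSum R F k γ

/-- The tuple `f` with `m` put in front. -/
def path (m : ℕ) {n : ℕ} (f : Fin n → ℕ+) : Fin (n + 1) → ℕ :=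
  Fin.cons m fun i => (f i : ℕ)

variable {R : ℕ → ℕ → Prop} {F G : ℕ → ℝ≥0∞}

theorem tsum_prod_pair {ι κ : Type*} (f : ι × κ → ℝ≥0∞) :
    ∑' p, f p = ∑' i, ∑' j, f (i, j) :=
  ENNReal.summable.tsum_prod' fun _ => ENNReal.summable

theorem chainSum_eq_tsum (γ : List ℕ) (m : ℕ) :
    chainSum R F m γ = ∑' f : Fin γ.length → ℕ+,
      ind (∀ i : Fin γ.length, R (path m f i.castSucc) (path m f i.succ)) *
        (∏ i, weight (γ.get i) (f i)) * F (path m f (Fin.last _)) := by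
  induction γ generalizing m with
  | nil =>
    rw [tsum_eq_single (fun i => i.elim0) (fun f hf => (hf (funext fun i => i.elim0)).elim)]
    simp [chainSum, ind, path]
  | cons b γ ih =>
    refine Eq.trans ?_ ((Fin.consEquiv fun _ : Fin (γ.length + 1) => ℕ+).tsum_eq _)
    rw [tsum_prod_pair]
    simp only [chainSum]
    refine tsum_congr fun k => ?_
    rw [ih, ← ENNReal.tsum_mul_left]
    refine tsum_congr fun f => ?_
    have hpath : ∀ i : Fin (γ.length + 1),
        path m (Fin.cons k f : Fin (γ.length + 1) → ℕ+) i.succ = path k f i := by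
      intro i
      refine Fin.cases ?_ (fun j => ?_) i <;> simp [path]
    have hind : ind (∀ i : Fin (γ.length + 1),
        R (path m (Fin.cons k f : Fin (γ.length + 1) → ℕ+) i.castSucc)
          (path m (Fin.cons k f : Fin (γ.length + 1) → ℕ+) i.succ)) =
        ind (R m k) *
          ind (∀ i : Fin γ.length, R (path k f i.castSucc) (path k f i.succ)) := by
      rw [← ind_and]
      congr 1
      rw [Fin.forall_fin_succ]
      simp only [hpath, ← Fin.succ_castSucc]
      simp [path]
    have hprod : ∏ i : Fin (γ.length + 1),
        weight ((b :: γ).get i) ((Fin.cons k f : Fin (γ.length + 1) → ℕ+) i) =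
        weight b k * ∏ i : Fin γ.length, weight (γ.get i) (f i) := by
      rw [Fin.prod_univ_succ]
      simp
    have hlast := hpath (Fin.last _)
    rw [Fin.succ_last] at hlast
    change _ = ind (∀ i : Fin (γ.length + 1),
        R (path m (Fin.cons k f : Fin (γ.length + 1) → ℕ+) i.castSucc)
          (path m (Fin.cons k f : Fin (γ.length + 1) → ℕ+) i.succ)) *
      (∏ i : Fin (γ.length + 1),
        weight ((b :: γ).get i) ((Fin.cons k f : Fin (γ.length + 1) → ℕ+) i)) *
      F (path m (Fin.cons k f : Fin (γ.length + 1) → ℕ+) (Fin.last (γ.length + 1)))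
    rw [hind, hprod, hlast]
    ring

theorem chainSum_append (α β : List ℕ) (m : ℕ) :
    chainSum R F m (α ++ β) = chainSum R (fun n => chainSum R F n β) m α := by
  induction α generalizing m with
  | nil => rfl
  | cons b γ ih => simp [chainSum, ih]

theorem chainSum_add (γ : List ℕ) (m : ℕ) :
    chainSum R (fun n => F n + G n) m γ = chainSum R F m γ + chainSum R G m γ := by
  induction γ generalizing m with
  | nil => rfl
  | cons b γ ih => simp only [chainSum, ih, mul_add, ENNReal.tsum_add]

theorem chainSum_const_mul (c : ℝ≥0∞) (γ : List ℕ) (m : ℕ) :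
    chainSum R (fun n => c * F n) m γ = c * chainSum R F m γ := by
  induction γ generalizing m with
  | nil => rfl
  | cons b γ ih => simp only [chainSum, ih, mul_left_comm _ c, ENNReal.tsum_mul_left]

theorem chainSum_mono (h : ∀ n, F n ≤ G n) (γ : List ℕ) (m : ℕ) :
    chainSum R F m γ ≤ chainSum R G m γ := by
  induction γ generalizing m with
  | nil => exact h m
  | cons b γ ih => exact ENNReal.tsum_le_tsum fun k => by gcongr; exact ih k

theorem chainSum_lt_zero_cons (b : ℕ) (γ : List ℕ) (n : ℕ) :
    chainSum (· < ·) F 0 (b :: γ) = chainSum (· < ·) F n (b :: γ) +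
      chainSum (· ≥ ·) (fun x => chainSum (· < ·) F x γ) n [b] := by
  simp only [chainSum]
  rw [← ENNReal.tsum_add]
  refine tsum_congr fun k => ?_
  rw [← add_mul, ← add_mul]
  congr 2
  by_cases h : n < k
  · simp [ind, h, not_le.mpr h]
  · simp [ind, h, not_lt.mp h]

theorem strictMono_iff_path {n : ℕ} (f : Fin n → ℕ+) :
    StrictMono f ↔ ∀ i : Fin n, path 0 f i.castSucc < path 0 f i.succ := by
  rw [← Fin.strictMono_iff_lt_succ]
  constructor
  · intro hf i
    refine Fin.cases (fun j => ?_) (fun i j => ?_) i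
    · refine Fin.cases (fun h => (lt_irrefl _ h).elim) (fun j _ => ?_) j
      simp [path]
    · refine Fin.cases (fun h => (Fin.not_lt_zero _ h).elim) (fun j h => ?_) j
      simpa [path] using hf (Fin.succ_lt_succ_iff.mp h)
  · intro hf i j hij
    have := hf (Fin.succ_lt_succ_iff.mpr hij)
    simpa [path] using this

theorem antitone_path_iff {n : ℕ} (m : ℕ) (f : Fin n → ℕ+) :
    (∀ i : Fin n, path m f i.castSucc ≥ path m f i.succ) ↔
      Antitone f ∧ ∀ i : Fin n, (i : ℕ) = 0 → (f i : ℕ) ≤ m := by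
  rw [show (∀ i : Fin n, path m f i.castSucc ≥ path m f i.succ) ↔ Antitone (path m f) from
    Fin.antitone_iff_succ_le.symm]
  constructor
  · intro hf
    refine ⟨fun i j hij => ?_, fun i _ => ?_⟩
    · have := hf (Fin.succ_le_succ_iff.mpr hij)
      simpa [path] using this
    · have := hf (Fin.zero_le i.succ)
      simpa [path] using this
  · rintro ⟨hf, h0⟩ i
    refine Fin.cases (fun j => ?_) (fun i j => ?_) i
    · refine Fin.cases (fun _ => le_rfl) (fun j _ => ?_) j
      have h1 : (f j : ℕ) ≤ f ⟨0, j.pos⟩ := by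
        exact_mod_cast hf (show (⟨0, j.pos⟩ : Fin n) ≤ j from Nat.zero_le _)
      simpa [path] using h1.trans (h0 ⟨0, j.pos⟩ rfl)
    · refine Fin.cases (fun h => (Fin.not_lt_zero _ (lt_of_lt_of_le (Fin.succ_pos i) h)).elim)
        (fun j h => ?_) j
      simpa [path] using hf (Fin.succ_le_succ_iff.mp h)

theorem tsum_subtype_toReal {ι : Type*} (p : ι → Prop) (g : ι → ℝ≥0∞) (hg : ∀ i, g i ≠ ∞) :
    ∑' i : {i // p i}, (g i).toReal = (∑' i, ind (p i) * g i).toReal := by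
  rw [← ENNReal.tsum_toReal_eq fun i : {i // p i} => hg i]
  congr 1
  refine (tsum_subtype {i | p i} g).trans ?_
  refine tsum_congr fun i => ?_
  by_cases h : p i <;> simp [ind, h]

theorem prod_weight_ne_top {n : ℕ} (a : Fin n → ℕ) (f : Fin n → ℕ+) :
    ∏ i, weight (a i) (f i) ≠ ∞ :=
  ENNReal.prod_ne_top fun _ _ => weight_ne_top _ _

theorem mzv_eq (α : List ℕ) : mzv α = (chainSum (· < ·) 1 0 α).toReal := by
  rw [chainSum_eq_tsum]
  simp only [← strictMono_iff_path, Pi.one_apply, mul_one]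
  rw [← tsum_subtype_toReal _ _ (prod_weight_ne_top _)]
  simp only [ENNReal.toReal_prod, toReal_weight]
  rfl

theorem chainSum_ge_eq_tsum (δ : List ℕ) (n : ℕ) :
    chainSum (· ≥ ·) 1 n δ.reverse = ∑' g : Fin δ.length → ℕ+,
      ind (Monotone g ∧ ∀ j : Fin δ.length, (j : ℕ) = δ.length - 1 → (g j : ℕ) ≤ n) *
        ∏ j, weight (δ.get j) (g j) := by
  rw [chainSum_eq_tsum]
  simp only [antitone_path_iff, Pi.one_apply, mul_one]
  let e : Fin δ.length ≃ Fin δ.reverse.length :=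
    Fin.revPerm.trans (finCongr List.length_reverse.symm)
  have he : ∀ i, ((e i : Fin _) : ℕ) = δ.length - 1 - i := by
    intro i
    simp [e]
    omega
  rw [← (e.arrowCongr (Equiv.refl ℕ+)).tsum_eq]
  refine tsum_congr fun g => ?_
  have hg : ∀ i, (e.arrowCongr (Equiv.refl ℕ+)) g (e i) = g i := by
    intro i
    simp
  congr 1
  · congr 1
    apply propext
    refine and_congr ⟨fun h i j hij => ?_, fun h i j hij => ?_⟩ ?_
    · rw [← hg i, ← hg j]
      apply h
      rw [Fin.le_def, he, he]
      have : (i : ℕ) ≤ j := hij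
      omega
    · obtain ⟨i, rfl⟩ := e.surjective i
      obtain ⟨j, rfl⟩ := e.surjective j
      rw [hg, hg]
      apply h
      rw [Fin.le_def, he, he] at hij
      rw [Fin.le_def]
      omega
    · rw [← e.forall_congr_right]
      refine forall_congr' fun i => ?_
      rw [hg, he]
      refine imp_congr_left ?_
      omega
  · rw [← e.prod_comp]
    refine Finset.prod_congr rfl fun i _ => ?_
    rw [hg]
    congr 1
    simp only [List.get_eq_getElem, List.getElem_reverse, he]
    congr 1
    omega

theorem path_last {n : ℕ} (m : ℕ) (f : Fin n → ℕ+) (i : Fin n) (hi : (i : ℕ) = n - 1) :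
    path m f (Fin.last n) = f i := by
  have h : Fin.last n = i.succ := by
    ext
    simp
    omega
  rw [h]
  simp [path]

theorem ZU_eq (α δ : List ℕ) (hα : α ≠ []) :
    ZU α δ = (chainSum (· < ·) (fun n => chainSum (· ≥ ·) 1 n δ.reverse) 0 α).toReal := by
  have hpos : 0 < α.length := List.length_pos_iff.mpr hα
  have key := tsum_subtype_toReal
    (fun p : (Fin α.length → ℕ+) × (Fin δ.length → ℕ+) => StrictMono p.1 ∧ Monotone p.2 ∧
      ∀ j : Fin δ.length, (j : ℕ) = δ.length - 1 →
        ∀ i : Fin α.length, (i : ℕ) = α.length - 1 → p.2 j ≤ p.1 i)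
    (fun p => (∏ i, weight (α.get i) (p.1 i)) * ∏ j, weight (δ.get j) (p.2 j))
    (fun p => ENNReal.mul_ne_top (prod_weight_ne_top _ _) (prod_weight_ne_top _ _))
  simp only [ENNReal.toReal_mul, ENNReal.toReal_prod, toReal_weight] at key
  refine Eq.trans key ?_
  rw [tsum_prod_pair, chainSum_eq_tsum]
  congr 1
  refine tsum_congr fun f => ?_
  rw [chainSum_ge_eq_tsum, ← ENNReal.tsum_mul_left]
  refine tsum_congr fun g => ?_
  have hlast : ∀ j : Fin δ.length,
      ((g j : ℕ) ≤ path 0 f (Fin.last _)) ↔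
        ∀ i : Fin α.length, (i : ℕ) = α.length - 1 → g j ≤ f i := by
    intro j
    constructor
    · intro h i hi
      rw [path_last 0 f i hi] at h
      exact_mod_cast h
    · intro h
      rw [path_last 0 f ⟨α.length - 1, by omega⟩ rfl]
      exact_mod_cast h ⟨α.length - 1, by omega⟩ rfl
  simp only [← strictMono_iff_path, hlast, ind_and]
  ring

/-! ### Finiteness -/

theorem tsum_pnat_ofReal_le {g : ℕ → ℝ} (hg : ∀ n, 0 ≤ g n) {B : ℝ}
    (h : ∀ N, ∑ j ∈ Finset.range N, g (j + 1) ≤ B) :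
    ∑' k : ℕ+, ENNReal.ofReal (g k) ≤ ENNReal.ofReal B := by
  rw [tsum_pnat_eq_tsum_succ (f := fun k => ENNReal.ofReal (g k))]
  refine ENNReal.tsum_le_of_sum_range_le fun N => ?_
  rw [← ENNReal.ofReal_sum_of_nonneg fun j _ => hg _]
  exact ENNReal.ofReal_le_ofReal (h N)

theorem weight_eq_ofReal (b : ℕ) (k : ℕ+) : weight b k = ENNReal.ofReal (((k : ℝ) ^ b)⁻¹) := by
  rw [← toReal_weight, ENNReal.ofReal_toReal (weight_ne_top b k)]

theorem sqrt_div_le_sub {x : ℝ} (hx : 1 ≤ x) :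
    x⁻¹ * √(x + 1) ≤ 4 * (√(x + 1) - √x) := by
  have h1 : √x ^ 2 = x := Real.sq_sqrt (by linarith)
  have h2 : √(x + 1) ^ 2 = x + 1 := Real.sq_sqrt (by linarith)
  have h3 : 0 < √x := Real.sqrt_pos.mpr (by linarith)
  have h4 : √x < √(x + 1) := Real.sqrt_lt_sqrt (by linarith) (by linarith)
  set a := √x
  set c := √(x + 1)
  have h5 : (c - a) * (c + a) = 1 := by nlinarith
  have h6 : 1 ≤ (c - a) * (2 * c) := by nlinarith
  rw [inv_mul_le_iff₀ (by linarith)]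
  have h7 : c * c ≤ 2 * x := by nlinarith
  have h8 : c * 1 ≤ c * ((c - a) * (2 * c)) := by gcongr
  nlinarith [mul_le_mul_of_nonneg_right h7 (by linarith : 0 ≤ c - a)]

theorem sqrt_div_sq_le_sub {x : ℝ} (hx : 1 ≤ x) :
    (x ^ 2)⁻¹ * √(x + 1) ≤ 8 * ((√x)⁻¹ - (√(x + 1))⁻¹) := by
  have h := sqrt_div_le_sub hx
  have h1 : √x ^ 2 = x := Real.sq_sqrt (by linarith)
  have h2 : √(x + 1) ^ 2 = x + 1 := Real.sq_sqrt (by linarith)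
  have h3 : 0 < √x := Real.sqrt_pos.mpr (by linarith)
  have h4 : √x < √(x + 1) := Real.sqrt_lt_sqrt (by linarith) (by linarith)
  set a := √x
  set c := √(x + 1)
  have h5 : c ≤ 2 * a := by nlinarith
  have hc : 0 < c := by linarith
  have h6 : a⁻¹ - c⁻¹ = (c - a) * (a * c)⁻¹ := by field_simp
  have h7 : x⁻¹ ≤ 2 * (a * c)⁻¹ := by
    rw [← h1, ← div_eq_mul_inv, inv_eq_one_div, div_le_div_iff₀ (by positivity) (by positivity)]
    nlinarith
  rw [h6]
  calc (x ^ 2)⁻¹ * c = x⁻¹ * (x⁻¹ * c) := by rw [pow_two, mul_inv]; ring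
    _ ≤ x⁻¹ * (4 * (c - a)) := by gcongr
    _ ≤ 2 * (a * c)⁻¹ * (4 * (c - a)) := by
        gcongr
    _ = _ := by ring

theorem tsum_ge_le (n : ℕ) :
    ∑' k : ℕ+, ind (n ≥ k) * weight 1 k * ENNReal.ofReal √((k : ℕ) + 1) ≤
      4 * ENNReal.ofReal √((n : ℝ) + 1) := by
  classical
  have h4 : (4 : ℝ≥0∞) * ENNReal.ofReal √((n : ℝ) + 1) =
      ENNReal.ofReal (4 * √((n : ℝ) + 1)) := by
    rw [ENNReal.ofReal_mul (by norm_num)]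
    norm_num
  rw [h4]
  refine le_trans (le_of_eq (tsum_congr fun k => ?_)) (tsum_pnat_ofReal_le
    (g := fun k => if k ≤ n then (k : ℝ)⁻¹ * √((k : ℝ) + 1) else 0) ?_ ?_)
  · by_cases h : (k : ℕ) ≤ n
    · simp only [weight_eq_ofReal, ind, h, if_true, one_mul, pow_one]
      rw [← ENNReal.ofReal_mul (by positivity)]
    · simp [ind, h]
  · intro k
    positivity
  · intro N
    have : ∑ j ∈ Finset.range N, (if j + 1 ≤ n then ((j + 1 : ℕ) : ℝ)⁻¹ *
        √(((j + 1 : ℕ) : ℝ) + 1) else 0) ≤ 4 * √((min N n : ℕ) + 1) := by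
      induction N with
      | zero => simp
      | succ N ih =>
        rw [Finset.sum_range_succ]
        by_cases h : N + 1 ≤ n
        · rw [if_pos h, min_eq_left h]
          rw [min_eq_left (by omega)] at ih
          have := sqrt_div_le_sub (x := ((N + 1 : ℕ) : ℝ)) (by simp)
          push_cast at this ih ⊢
          linarith
        · rw [if_neg h, min_eq_right (by omega)]
          rw [min_eq_right (by omega)] at ih
          linarith
    refine this.trans ?_
    gcongr
    exact min_le_right _ _

theorem tsum_lt_le (m : ℕ) :
    ∑' k : ℕ+, ind (m < k) * weight 2 k * ENNReal.ofReal √((k : ℕ) + 1) ≤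
      8 * ENNReal.ofReal (√((m : ℝ) + 1))⁻¹ := by
  classical
  have h8 : (8 : ℝ≥0∞) * ENNReal.ofReal (√((m : ℝ) + 1))⁻¹ =
      ENNReal.ofReal (8 * (√((m : ℝ) + 1))⁻¹) := by
    rw [ENNReal.ofReal_mul (by norm_num)]
    norm_num
  rw [h8]
  refine le_trans (le_of_eq (tsum_congr fun k => ?_)) (tsum_pnat_ofReal_le
    (g := fun k => if m < k then ((k : ℝ) ^ 2)⁻¹ * √((k : ℝ) + 1) else 0) ?_ ?_)
  · by_cases h : m < (k : ℕ)
    · simp only [weight_eq_ofReal, ind, h, if_true, one_mul]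
      rw [← ENNReal.ofReal_mul (by positivity)]
    · simp [ind, h]
  · intro k
    positivity
  · intro N
    have : ∑ j ∈ Finset.range N, (if m < j + 1 then (((j + 1 : ℕ) : ℝ) ^ 2)⁻¹ *
        √(((j + 1 : ℕ) : ℝ) + 1) else 0) + 8 * (√((max N m : ℕ) + 1))⁻¹ ≤
          8 * (√((m : ℝ) + 1))⁻¹ := by
      induction N with
      | zero => simp
      | succ N ih =>
        rw [Finset.sum_range_succ]
        by_cases h : m < N + 1
        · rw [if_pos h, max_eq_left h.le]
          rw [max_eq_left (by omega)] at ih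
          have := sqrt_div_sq_le_sub (x := ((N + 1 : ℕ) : ℝ)) (by simp)
          push_cast at this ih ⊢
          linarith
        · rw [if_neg h, max_eq_right (by omega)]
          rw [max_eq_right (by omega)] at ih
          linarith
    have h0 : 0 ≤ 8 * (√((max N m : ℕ) + 1))⁻¹ := by positivity
    linarith

theorem chainSum_ge_le (γ : List ℕ) (hγ : ∀ x ∈ γ, 0 < x) (n : ℕ) :
    chainSum (· ≥ ·) 1 n γ ≤ 4 ^ γ.length * ENNReal.ofReal √((n : ℝ) + 1) := by
  induction γ generalizing n with
  | nil =>
    simp only [chainSum, Pi.one_apply, List.length_nil, pow_zero, one_mul]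
    rw [ENNReal.one_le_ofReal, Real.one_le_sqrt]
    have : (0 : ℝ) ≤ n := n.cast_nonneg
    linarith
  | cons b γ ih =>
    simp only [chainSum, List.length_cons]
    calc ∑' k : ℕ+, ind (n ≥ k) * weight b k * chainSum (· ≥ ·) 1 k γ
        ≤ ∑' k : ℕ+, 4 ^ γ.length *
            (ind (n ≥ k) * weight 1 k * ENNReal.ofReal √((k : ℕ) + 1)) := by
          refine ENNReal.tsum_le_tsum fun k => ?_
          rw [mul_left_comm]
          gcongr
          · exact weight_le_weight (hγ b (by simp)) k
          · exact ih (fun x hx => hγ x (by simp [hx])) k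
      _ ≤ 4 ^ γ.length * (4 * ENNReal.ofReal √((n : ℝ) + 1)) := by
          rw [ENNReal.tsum_mul_left]
          gcongr
          exact tsum_ge_le n
      _ = _ := by rw [pow_succ, mul_assoc]

theorem weight_one_mul_le (k : ℕ+) :
    weight 1 k * ENNReal.ofReal (√((k : ℕ) + 1))⁻¹ ≤
      weight 2 k * ENNReal.ofReal √((k : ℕ) + 1) := by
  rw [weight_eq_ofReal, weight_eq_ofReal, ← ENNReal.ofReal_mul (by positivity),
    ← ENNReal.ofReal_mul (by positivity)]
  refine ENNReal.ofReal_le_ofReal ?_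
  have hk : (0 : ℝ) < (k : ℕ) := by exact_mod_cast k.pos
  have hs : 0 < √(((k : ℕ) : ℝ) + 1) := Real.sqrt_pos.mpr (by linarith)
  have h2 : √(((k : ℕ) : ℝ) + 1) ^ 2 = (k : ℕ) + 1 := Real.sq_sqrt (by linarith)
  rw [← mul_inv, pow_one, inv_mul_eq_div, inv_eq_one_div, div_le_div_iff₀ (by positivity)
    (by positivity)]
  nlinarith

theorem chainSum_lt_le (γ : List ℕ) (hγ : ∀ x ∈ γ, 0 < x) (hne : γ ≠ [])
    (hlast : 2 ≤ γ.getLast hne) (m : ℕ) :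
    chainSum (· < ·) (fun n => ENNReal.ofReal √((n : ℝ) + 1)) m γ ≤
      8 ^ γ.length * ENNReal.ofReal (√((m : ℝ) + 1))⁻¹ := by
  induction γ generalizing m with
  | nil => exact (hne rfl).elim
  | cons b γ ih =>
    suffices h : ∀ k : ℕ+, weight b k *
        chainSum (· < ·) (fun n => ENNReal.ofReal √((n : ℝ) + 1)) k γ ≤
          8 ^ γ.length * (weight 2 k * ENNReal.ofReal √((k : ℕ) + 1)) by
      calc ∑' k : ℕ+, ind (m < k) * weight b k *
            chainSum (· < ·) (fun n => ENNReal.ofReal √((n : ℝ) + 1)) k γ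
          ≤ ∑' k : ℕ+, 8 ^ γ.length *
            (ind (m < k) * weight 2 k * ENNReal.ofReal √((k : ℕ) + 1)) := by
            refine ENNReal.tsum_le_tsum fun k => ?_
            rw [mul_assoc, mul_assoc (ind _) (weight 2 k), mul_left_comm (8 ^ γ.length)]
            gcongr ind _ * ?_
            exact h k
        _ ≤ 8 ^ γ.length * (8 * ENNReal.ofReal (√((m : ℝ) + 1))⁻¹) := by
            rw [ENNReal.tsum_mul_left]
            gcongr
            exact tsum_lt_le m
        _ = _ := by rw [List.length_cons, pow_succ, mul_assoc]
    intro k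
    by_cases hγne : γ = []
    · subst hγne
      simp only [chainSum, List.length_nil, pow_zero, one_mul]
      gcongr
      exact weight_le_weight (by simpa using hlast) k
    · have hrec := ih (fun x hx => hγ x (by simp [hx])) hγne
        (by rwa [List.getLast_cons hγne] at hlast) k
      calc _ ≤ weight 1 k * (8 ^ γ.length * ENNReal.ofReal (√((k : ℕ) + 1))⁻¹) := by
            gcongr
            exact weight_le_weight (hγ b (by simp)) k
        _ = 8 ^ γ.length * (weight 1 k * ENNReal.ofReal (√((k : ℕ) + 1))⁻¹) := by
            rw [mul_left_comm]
        _ ≤ _ := by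
            gcongr 8 ^ γ.length * ?_
            exact weight_one_mul_le k

theorem chainSum_lt_ne_top (γ : List ℕ) (hγ : ∀ x ∈ γ, 0 < x) (hne : γ ≠ [])
    (hlast : 2 ≤ γ.getLast hne) (C : ℝ≥0∞) (hC : C ≠ ∞)
    (hF : ∀ n : ℕ, F n ≤ C * ENNReal.ofReal √((n : ℝ) + 1)) (m : ℕ) :
    chainSum (· < ·) F m γ ≠ ∞ := by
  refine ne_top_of_le_ne_top ?_ (chainSum_mono hF γ m)
  rw [chainSum_const_mul]
  refine ENNReal.mul_ne_top hC (ne_top_of_le_ne_top ?_ (chainSum_lt_le γ hγ hne hlast m))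
  exact ENNReal.mul_ne_top (ENNReal.pow_ne_top (by norm_num)) ENNReal.ofReal_ne_top

theorem mzv_chainSum_ne_top (γ : List ℕ) (hγ : ∀ x ∈ γ, 0 < x)
    (hlast : ∀ h : γ ≠ [], 2 ≤ γ.getLast h) : chainSum (· < ·) 1 0 γ ≠ ∞ := by
  by_cases hne : γ = []
  · simp [hne, chainSum]
  · refine chainSum_lt_ne_top γ hγ hne (hlast hne) 1 (by simp) (fun n => ?_) 0
    simp

/-! ### The telescoping identity -/

/-- The sum over chains `k₁ < ⋯ < k_r ≥ x₁ ≥ ⋯ ≥ x_j < x_{j+1} < ⋯ < x_m`. -/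
noncomputable def zigzag (α β : List ℕ) (j : ℕ) : ℝ≥0∞ :=
  chainSum (· < ·) (fun n => chainSum (· ≥ ·)
    (fun x => chainSum (· < ·) 1 x (β.drop j)) n (β.take j)) 0 α

theorem mul_eq_chainSum (c : ℝ≥0∞) (α γ : List ℕ) :
    c * chainSum (· < ·) (fun n => chainSum (· ≥ ·) 1 n γ) 0 α =
      chainSum (· < ·) (fun n => chainSum (· ≥ ·) (fun _ => c) n γ) 0 α := by
  rw [← chainSum_const_mul]
  congr 1
  funext n
  rw [← chainSum_const_mul]
  simp

theorem mul_eq_zigzag_add (α β : List ℕ) {j : ℕ} (hj : j < β.length) :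
    chainSum (· < ·) 1 0 (β.drop j) *
        chainSum (· < ·) (fun n => chainSum (· ≥ ·) 1 n (β.take j)) 0 α =
      zigzag α β j + zigzag α β (j + 1) := by
  rw [mul_eq_chainSum, zigzag, zigzag, ← chainSum_add]
  congr 1
  funext n
  rw [← List.take_concat_get' β j hj, chainSum_append, ← chainSum_add]
  congr 1
  funext x
  rw [List.drop_eq_getElem_cons hj]
  exact chainSum_lt_zero_cons _ _ _

theorem mul_eq_zigzag (α β : List ℕ) :
    chainSum (· < ·) 1 0 (β.drop β.length) *
        chainSum (· < ·) (fun n => chainSum (· ≥ ·) 1 n (β.take β.length)) 0 α =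
      zigzag α β β.length := by
  rw [mul_eq_chainSum, zigzag]
  simp [chainSum]

theorem sum_alternating (b : ℕ → ℝ) (m : ℕ) :
    ∑ k ∈ Finset.range m, (-1 : ℝ) ^ k * (b k + b (k + 1)) = b 0 - (-1) ^ m * b m := by
  induction m with
  | zero => simp
  | succ m ih =>
    rw [Finset.sum_range_succ, ih]
    ring

end ChainSum

open ChainSum in
/-- Proposition 3.1, Eq. (3.1). -/
theorem stmt_9 (α β : List ℕ)
    (hαpos : ∀ x ∈ α, 0 < x) (hβpos : ∀ x ∈ β, 0 < x)
    (hαne : α ≠ []) (hα : 2 ≤ α.getLast hαne)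
    (hβ : ∀ h : β ≠ [], 2 ≤ β.getLast h) :
    ∑ k ∈ Finset.range (β.length + 1),
      (-1 : ℝ) ^ k * mzv (β.drop k) * ZU α ((β.take k).reverse)
    = mzv (α ++ β) := by
  have hterm : ∀ k, mzv (β.drop k) * ZU α ((β.take k).reverse) =
      (chainSum (· < ·) 1 0 (β.drop k) *
        chainSum (· < ·) (fun n => chainSum (· ≥ ·) 1 n (β.take k)) 0 α).toReal := by
    intro k
    rw [mzv_eq, ZU_eq _ _ hαne, List.reverse_reverse, ENNReal.toReal_mul]
  have hfin : ∀ k, chainSum (· < ·) 1 0 (β.drop k) *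
      chainSum (· < ·) (fun n => chainSum (· ≥ ·) 1 n (β.take k)) 0 α ≠ ∞ := by
    intro k
    refine ENNReal.mul_ne_top (mzv_chainSum_ne_top _
      (fun x hx => hβpos x (List.mem_of_mem_drop hx)) fun h => ?_) ?_
    · rw [List.getLast_drop]
      exact hβ _
    · exact chainSum_lt_ne_top α hαpos hαne hα (4 ^ (β.take k).length)
        (ENNReal.pow_ne_top (by norm_num))
        (fun n => chainSum_ge_le _ (fun x hx => hβpos x (List.mem_of_mem_take hx)) n) 0
  have hstep : ∀ k ∈ Finset.range β.length,
      (-1 : ℝ) ^ k * mzv (β.drop k) * ZU α ((β.take k).reverse) =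
        (-1) ^ k * ((zigzag α β k).toReal + (zigzag α β (k + 1)).toReal) := by
    intro k hk
    have hk' := mul_eq_zigzag_add α β (Finset.mem_range.mp hk)
    have hsum := hfin k
    rw [hk', ENNReal.add_ne_top] at hsum
    rw [mul_assoc, hterm, hk', ENNReal.toReal_add hsum.1 hsum.2]
  rw [Finset.sum_range_succ, Finset.sum_congr rfl hstep,
    sum_alternating fun k => (zigzag α β k).toReal, mul_assoc, hterm, mul_eq_zigzag,
    sub_add_cancel, mzv_eq, chainSum_append]
  simp [zigzag, chainSum]
end

section
/- Let α = (α_1,…,α_r) and β = (β_1,…,β_m) be tuples of positive integers with α_i ≥ 2 for all 1 ≤ i ≤ r and β_m ≥ 2. Then Σ_{k=0}^{r} (-1)^{r-k} · ζ(α_1,…,α_k) · Z_L(β; (α_r, α_{r-1},…,α_{k+1})) = ζ(α_1,…,α_r, β_1,…,β_m). -/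
open scoped BigOperators

/-- The summand `k₁^{-α₁} ⋯ k_r^{-α_r}` attached to a list of indices `k₁, …, k_r`. -/
noncomputable def zetaWeight (α : List ℕ) (l : List ℕ+) : ℝ :=
  (List.zipWith (fun (k : ℕ+) (s : ℕ) => ((k : ℝ) ^ s)⁻¹) l α).prod

/-- Lists of `n` strictly increasing indices. -/
def strictLists (n : ℕ) : Set (List ℕ+) := {l | l.length = n ∧ l.IsChain (· < ·)}

/-- The index set of the series `ZL`, in terms of lists. -/
def lowerPairs (r m : ℕ) : Set (List ℕ+ × List ℕ+) :=
  {p | p.1 ∈ strictLists r ∧ p.2.length = m ∧ (p.1.take 1 ++ p.2).IsChain (· ≤ ·)}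

lemma zetaWeight_nonneg (α : List ℕ) (l : List ℕ+) : 0 ≤ zetaWeight α l := by
  refine List.prod_nonneg fun a ha => ?_
  obtain ⟨i, hi, rfl⟩ := List.mem_iff_getElem.1 ha
  simp only [List.getElem_zipWith]
  positivity

lemma zetaWeight_append {α γ : List ℕ} {l l' : List ℕ+} (h : l.length = α.length) :
    zetaWeight (α ++ γ) (l ++ l') = zetaWeight α l * zetaWeight γ l' := by
  rw [zetaWeight, List.zipWith_append h, List.prod_append, zetaWeight, zetaWeight]

lemma zetaWeight_reverse {α : List ℕ} {l : List ℕ+} (h : l.length = α.length) :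
    zetaWeight α.reverse l.reverse = zetaWeight α l := by
  rw [zetaWeight, ← List.reverse_zipWith h, List.prod_reverse, zetaWeight]

lemma zetaWeight_ofFn (α : List ℕ) (f : Fin α.length → ℕ+) :
    zetaWeight α (List.ofFn f) = ∏ i : Fin α.length, ((f i : ℝ) ^ (α.get i))⁻¹ := by
  rw [← List.prod_ofFn, zetaWeight]
  congr 1
  apply List.ext_getElem <;> simp

lemma isChain_lt_ofFn {n : ℕ} (f : Fin n → ℕ+) :
    (List.ofFn f).IsChain (· < ·) ↔ StrictMono f := by
  rw [List.isChain_iff_pairwise, List.pairwise_ofFn]; rfl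

lemma isChain_le_ofFn {n : ℕ} (f : Fin n → ℕ+) :
    (List.ofFn f).IsChain (· ≤ ·) ↔ Monotone f := by
  rw [← List.sortedLE_iff_isChain, List.sortedLE_ofFn_iff]

lemma exists_ofFn_eq {n : ℕ} {l : List ℕ+} (h : l.length = n) :
    ∃ f : Fin n → ℕ+, List.ofFn f = l := by
  subst h
  exact ⟨l.get, List.ofFn_get l⟩

lemma mzv_eq_tsum_list (α : List ℕ) :
    mzv α = ∑' l, (strictLists α.length).indicator (zetaWeight α) l := by
  have hinj : Function.Injective
      (fun f : {f : Fin α.length → ℕ+ // StrictMono f} => List.ofFn f.1) :=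
    List.ofFn_injective.comp Subtype.val_injective
  rw [← hinj.tsum_eq]
  · refine tsum_congr fun f => ?_
    rw [Set.indicator_of_mem, zetaWeight_ofFn]
    exact ⟨List.length_ofFn, (isChain_lt_ofFn _).2 f.2⟩
  · intro l hl
    obtain ⟨hn, hc⟩ := Set.mem_of_indicator_ne_zero hl
    obtain ⟨f, rfl⟩ := exists_ofFn_eq hn
    exact ⟨⟨f, (isChain_lt_ofFn _).1 hc⟩, rfl⟩

lemma isChain_take_one_append_ofFn {r m : ℕ} (f : Fin r → ℕ+) (g : Fin m → ℕ+) :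
    ((List.ofFn f).take 1 ++ List.ofFn g).IsChain (· ≤ ·) ↔
      Monotone g ∧ ∀ i : Fin r, (i : ℕ) = 0 → ∀ j : Fin m, (j : ℕ) = 0 → f i ≤ g j := by
  rw [List.isChain_append, isChain_le_ofFn]
  cases r with
  | zero => simp
  | succ r =>
    cases m with
    | zero => simp
    | succ m =>
      have (n : ℕ) (P : Fin (n + 1) → Prop) : (∀ i : Fin (n + 1), (i : ℕ) = 0 → P i) ↔ P 0 :=
        ⟨fun h => h 0 rfl, fun h i hi => by rwa [Fin.ext (a := i) (b := 0) hi]⟩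
      rw [this, this]
      simp

lemma ZL_eq_tsum_list (α β : List ℕ) :
    ZL α β = ∑' p, (lowerPairs α.length β.length).indicator
      (fun p => zetaWeight α p.1 * zetaWeight β p.2) p := by
  have hinj : Function.Injective
      (fun p : {p : (Fin α.length → ℕ+) × (Fin β.length → ℕ+) //
        StrictMono p.1 ∧ Monotone p.2 ∧
        ∀ i : Fin α.length, (i : ℕ) = 0 →
          ∀ j : Fin β.length, (j : ℕ) = 0 → p.1 i ≤ p.2 j} =>
        (List.ofFn p.1.1, List.ofFn p.1.2)) :=
    (List.ofFn_injective.prodMap List.ofFn_injective).comp Subtype.val_injective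
  rw [← hinj.tsum_eq]
  · refine tsum_congr fun p => ?_
    rw [Set.indicator_of_mem, zetaWeight_ofFn, zetaWeight_ofFn]
    exact ⟨⟨List.length_ofFn, (isChain_lt_ofFn _).2 p.2.1⟩, List.length_ofFn,
      (isChain_take_one_append_ofFn _ _).2 p.2.2⟩
  · rintro ⟨l, l'⟩ hl
    obtain ⟨⟨hn, hc⟩, hn', hc'⟩ := Set.mem_of_indicator_ne_zero hl
    dsimp only at hn hc hn' hc'
    obtain ⟨f, rfl⟩ := exists_ofFn_eq hn
    obtain ⟨g, rfl⟩ := exists_ofFn_eq hn'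
    exact ⟨⟨(f, g), (isChain_lt_ofFn _).1 hc, (isChain_take_one_append_ofFn _ _).1 hc'⟩, rfl⟩

/-- Absolute convergence of the unrestricted product series with exponents greater than one. -/
lemma summable_prod_rpow (s : List ℝ) (hs : ∀ x ∈ s, 1 < x) :
    Summable ({l : List ℕ+ | l.length = s.length}.indicator
      fun l => (List.zipWith (fun (k : ℕ+) (x : ℝ) => (k : ℝ) ^ (-x)) l s).prod) := by
  induction s with
  | nil =>
    refine summable_of_ne_finset_zero (s := {[]}) fun l hl => ?_
    rw [Set.indicator_of_notMem]
    simpa using hl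
  | cons x s ih =>
    have hinj : Function.Injective (fun p : ℕ+ × List ℕ+ => p.1 :: p.2) := by
      rintro ⟨a, l⟩ ⟨b, l'⟩ h
      simpa using h
    rw [← hinj.summable_iff]
    · have hx : Summable fun k : ℕ+ => (k : ℝ) ^ (-x) :=
        (Real.summable_nat_rpow.2 (by linarith [hs x (by simp)])).comp_injective
          PNat.coe_injective
      refine (hx.mul_of_nonneg (ih fun y hy => hs y (by simp [hy]))
        (fun k => by positivity) ?_).congr ?_
      · refine fun l => Set.indicator_nonneg (fun l _ => List.prod_nonneg fun a ha => ?_) l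
        obtain ⟨i, hi, rfl⟩ := List.mem_iff_getElem.1 ha
        simp only [List.getElem_zipWith]
        positivity
      · rintro ⟨k, l⟩
        by_cases h : l.length = s.length <;> simp [Set.indicator, h]
    · intro l hl
      rw [Set.indicator_of_notMem]
      intro h
      cases l with
      | nil => simp at h
      | cons a l => exact hl ⟨(a, l), rfl⟩

lemma summable_zetaWeight {α : List ℕ} (hα : ∀ x ∈ α, 2 ≤ x) :
    Summable ({l : List ℕ+ | l.length = α.length}.indicator (zetaWeight α)) := by
  have h := summable_prod_rpow (α.map (↑)) (by
    intro x hx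
    obtain ⟨a, ha, rfl⟩ := List.mem_map.1 hx
    exact_mod_cast hα a ha)
  have hw : zetaWeight α =
      fun l => (List.zipWith (fun (k : ℕ+) (s : ℕ) => ((k : ℝ) ^ s)⁻¹) l α).prod := rfl
  rw [hw]
  simpa [List.zipWith_map_right, Real.rpow_neg] using h

lemma zetaWeight_le_prod_rpow {δ : ℝ} (hδ : 0 ≤ δ) (β : List ℕ) (hpos : ∀ x ∈ β, 0 < x)
    (hne : β ≠ []) (hlast : 2 ≤ β.getLast hne) (l : List ℕ+) (hl : l ≠ [])
    (hlen : l.length = β.length) (hc : l.IsChain (· < ·)) :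
    zetaWeight β l ≤ (l.map fun k : ℕ+ => (k : ℝ) ^ (-(1 + δ))).prod *
      ((l.getLast hl : ℕ+) : ℝ) ^ (-(1 - l.length * δ)) := by
  have hinv (k : ℕ+) (c s : ℕ) (h : c ≤ s) : ((k : ℝ) ^ s)⁻¹ ≤ (k : ℝ) ^ (-(c : ℝ)) := by
    rw [Real.rpow_neg (by positivity), Real.rpow_natCast]
    have : (1 : ℝ) ≤ k := by exact_mod_cast one_le
    gcongr
  induction l generalizing β with
  | nil => exact absurd rfl hl
  | cons k l ih =>
    have hk : (0 : ℝ) < k := by exact_mod_cast k.pos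
    obtain _ | ⟨s, β⟩ := β
    · exact absurd rfl hne
    obtain _ | ⟨k', l⟩ := l
    · obtain rfl : β = [] := by simpa using hlen.symm
      have := hinv k 2 s (by simpa using hlast)
      simp only [zetaWeight, List.zipWith_cons_cons, List.zipWith_nil_left, List.prod_cons,
        List.prod_nil, mul_one, List.map_cons, List.map_nil, List.getLast_singleton,
        List.length_singleton, ← Real.rpow_add hk]
      convert this using 2
      push_cast
      ring
    · have hβ : β ≠ [] := by rintro rfl; simp at hlen
      rw [List.isChain_cons_cons] at hc
      have key := ih β (fun x hx => hpos x (by simp [hx])) hβ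
        (by simpa [List.getLast_cons hβ] using hlast) (by simp) (by simpa using hlen) hc.2
      have hs := hinv k 1 s (hpos s (by simp))
      have hle : k ≤ (k' :: l).getLast (by simp) := by
        have hp := List.isChain_iff_pairwise.1 (List.isChain_cons_cons.2 hc)
        exact ((List.pairwise_cons.1 hp).1 _ (List.getLast_mem _)).le
      rw [List.getLast_cons (by simp)]
      set z := (k' :: l).getLast (by simp) with hz
      have hz0 : (0 : ℝ) < z := by exact_mod_cast z.pos
      have hzk : (z : ℝ) ^ (-δ) ≤ (k : ℝ) ^ (-δ) :=
        Real.rpow_le_rpow_of_nonpos hk (by exact_mod_cast hle) (by linarith)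
      set V := ((k' :: l).map fun k : ℕ+ => (k : ℝ) ^ (-(1 + δ))).prod with hV
      have hV0 : 0 ≤ V := by
        refine List.prod_nonneg fun a ha => ?_
        obtain ⟨n, -, rfl⟩ := List.mem_map.1 ha
        positivity
      rw [List.map_cons, List.prod_cons, ← hV]
      calc zetaWeight (s :: β) (k :: k' :: l)
          = ((k : ℝ) ^ s)⁻¹ * zetaWeight β (k' :: l) := by simp [zetaWeight]
        _ ≤ (k : ℝ) ^ (-((1 : ℕ) : ℝ)) * (V * (z : ℝ) ^ (-(1 - (k' :: l).length * δ))) := by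
            gcongr
            exact zetaWeight_nonneg _ _
        _ = (k : ℝ) ^ (-1 : ℝ) * V *
            ((z : ℝ) ^ (-δ) * (z : ℝ) ^ (-(1 - (k :: k' :: l).length * δ))) := by
            rw [← Real.rpow_add hz0, mul_assoc]
            congr 3
            · simp
            · push_cast [List.length_cons]
              ring_nf
        _ ≤ (k : ℝ) ^ (-1 : ℝ) * V *
            ((k : ℝ) ^ (-δ) * (z : ℝ) ^ (-(1 - (k :: k' :: l).length * δ))) := by
            gcongr
        _ = _ := by
            rw [neg_add, Real.rpow_add hk]
            ring

lemma summable_strictLists {β : List ℕ} (hpos : ∀ x ∈ β, 0 < x) (hne : β ≠ [])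
    (hlast : 2 ≤ β.getLast hne) :
    Summable ((strictLists β.length).indicator (zetaWeight β)) := by
  have hm : (0 : ℝ) < β.length := by exact_mod_cast List.length_pos_iff.2 hne
  set δ : ℝ := (β.length : ℝ)⁻¹ with hδ
  have hδ0 : 0 < δ := inv_pos.2 hm
  have h := summable_prod_rpow (List.replicate β.length (1 + δ)) (by
    intro x hx
    rw [List.eq_of_mem_replicate hx]
    linarith)
  refine h.of_nonneg_of_le
    (fun l => Set.indicator_nonneg (fun l _ => zetaWeight_nonneg _ _) l) fun l => ?_
  by_cases hl : l ∈ strictLists β.length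
  · obtain ⟨hlen, hc⟩ := hl
    have hl0 : l ≠ [] := by
      rintro rfl
      exact hne (List.length_eq_zero_iff.1 hlen.symm)
    rw [Set.indicator_of_mem (show l ∈ strictLists β.length from ⟨hlen, hc⟩),
      Set.indicator_of_mem (by simpa using hlen)]
    have key := zetaWeight_le_prod_rpow hδ0.le β hpos hne hlast l hl0 hlen hc
    have hz : List.zipWith (fun (k : ℕ+) (x : ℝ) => (k : ℝ) ^ (-x)) l
        (List.replicate β.length (1 + δ)) = l.map fun k : ℕ+ => (k : ℝ) ^ (-(1 + δ)) := by
      apply List.ext_getElem <;> simp [hlen]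
    rw [hz]
    rwa [hlen, hδ, mul_inv_cancel₀ hm.ne', sub_self, neg_zero, Real.rpow_zero, mul_one] at key
  · rw [Set.indicator_of_notMem hl]
    refine Set.indicator_nonneg (fun l _ => List.prod_nonneg fun a ha => ?_) l
    obtain ⟨i, hi, rfl⟩ := List.mem_iff_getElem.1 ha
    simp only [List.getElem_zipWith]
    positivity

lemma summable_lowerPairs {β γ : List ℕ} (hpos : ∀ x ∈ β, 0 < x) (hne : β ≠ [])
    (hlast : 2 ≤ β.getLast hne) (hγ : ∀ x ∈ γ, 2 ≤ x) :
    Summable ((lowerPairs β.length γ.length).indicator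
      fun p => zetaWeight β p.1 * zetaWeight γ p.2) := by
  have hw (p : List ℕ+ × List ℕ+) : 0 ≤ zetaWeight β p.1 * zetaWeight γ p.2 :=
    mul_nonneg (zetaWeight_nonneg _ _) (zetaWeight_nonneg _ _)
  refine ((summable_strictLists hpos hne hlast).mul_of_nonneg (summable_zetaWeight hγ)
    (fun l => Set.indicator_nonneg (fun l _ => zetaWeight_nonneg _ _) l)
    (fun l => Set.indicator_nonneg (fun l _ => zetaWeight_nonneg _ _) l)).of_nonneg_of_le
    (fun p => Set.indicator_nonneg (fun p _ => hw p) p) fun p => ?_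
  by_cases hp : p ∈ lowerPairs β.length γ.length
  · rw [Set.indicator_of_mem hp, Set.indicator_of_mem hp.1,
      Set.indicator_of_mem (show p.2 ∈ {l : List ℕ+ | l.length = γ.length} from hp.2.1)]
  · rw [Set.indicator_of_notMem hp]
    exact mul_nonneg (Set.indicator_nonneg (fun l _ => zetaWeight_nonneg _ _) _)
      (Set.indicator_nonneg (fun l _ => zetaWeight_nonneg _ _) _)

/-- Lists whose first `i` entries increase strictly and whose entries from position `j` on
decrease weakly. -/
def unimodalLists (i j : ℕ) : Set (List ℕ+) :=
  {L | (L.take i).IsChain (· < ·) ∧ (L.drop j).IsChain (· ≥ ·)}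

lemma indicator_unimodalLists_succ {L : List ℕ+} {j : ℕ} (hj : j + 1 < L.length) :
    (unimodalLists (j + 1) (j + 1)).indicator (1 : List ℕ+ → ℝ) L =
      (unimodalLists (j + 2) (j + 1)).indicator 1 L +
        (unimodalLists (j + 1) j).indicator 1 L := by
  have h₁ : (L.take (j + 2)).IsChain (· < ·) ↔
      (L.take (j + 1)).IsChain (· < ·) ∧ L[j] < L[j + 1] := by
    rw [← List.take_append_getElem hj, List.isChain_append]
    simp [List.getLast?_take, List.getElem?_eq_getElem (show j < L.length by omega)]
  have h₂ : (L.drop j).IsChain (· ≥ ·) ↔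
      L[j] ≥ L[j + 1] ∧ (L.drop (j + 1)).IsChain (· ≥ ·) := by
    rw [List.drop_eq_getElem_cons (show j < L.length by omega), List.drop_eq_getElem_cons hj,
      List.isChain_cons_cons]
  simp only [Set.indicator, unimodalLists, Set.mem_ofPred_eq, h₁, h₂, Pi.one_apply]
  by_cases h : L[j] < L[j + 1]
  · simp [h]
  · simp [h, not_lt.1 h]

lemma sum_indicator_unimodalLists {L : List ℕ+} {n : ℕ} (hn : n < L.length) :
    ∑ k ∈ Finset.range (n + 1),
      (-1 : ℝ) ^ (n - k) * (unimodalLists k k).indicator (1 : List ℕ+ → ℝ) L =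
        (unimodalLists (n + 1) n).indicator 1 L := by
  induction n with
  | zero =>
    rw [zero_add, Finset.sum_range_one, Nat.sub_zero, pow_zero, one_mul]
    obtain _ | ⟨a, L⟩ := L <;> simp [Set.indicator, unimodalLists]
  | succ n ih =>
    have hs : ∑ k ∈ Finset.range (n + 1),
        (-1 : ℝ) ^ (n + 1 - k) * (unimodalLists k k).indicator (1 : List ℕ+ → ℝ) L =
          -(unimodalLists (n + 1) n).indicator 1 L := by
      rw [← ih (by omega), ← Finset.sum_neg_distrib]
      refine Finset.sum_congr rfl fun k hk => ?_
      rw [Nat.sub_add_comm (Nat.lt_succ_iff.1 (Finset.mem_range.1 hk)), pow_succ]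
      ring
    rw [Finset.sum_range_succ, hs, indicator_unimodalLists_succ hn]
    simp

/-- Pairs `(l, b)` of index lists for `α` and `β`, with `b` strictly increasing. -/
def indexPairs (r m : ℕ) : Set (List ℕ+ × List ℕ+) :=
  {p | p.1.length = r ∧ p.2 ∈ strictLists m}

/-- The common summand of all the series in the identity, restricted to those pairs `(l, b)`
for which `l` followed by the first entry of `b` lies in `S`. -/
noncomputable def restrictedTerm (α β : List ℕ) (S : Set (List ℕ+))
    (p : List ℕ+ × List ℕ+) : ℝ :=
  (indexPairs α.length β.length).indicator (fun p => zetaWeight α p.1 * zetaWeight β p.2) p *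
    S.indicator 1 (p.1 ++ p.2.take 1)

lemma indicator_mul_indicator_eq_zero {X Y : Type*} {s : Set X} {t : Set Y} {f : X → ℝ}
    {g : Y → ℝ} {x : X} {y : Y} (h : ¬(x ∈ s ∧ y ∈ t)) :
    s.indicator f x * t.indicator g y = 0 := by
  by_contra h0
  exact h ⟨Set.mem_of_indicator_ne_zero (left_ne_zero_of_mul h0),
    Set.mem_of_indicator_ne_zero (right_ne_zero_of_mul h0)⟩

lemma restrictedTerm_unimodalLists (α β : List ℕ) {k : ℕ} (hk : k ≤ α.length)
    (p : List ℕ+ × List ℕ+) :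
    (strictLists (α.take k).length).indicator (zetaWeight (α.take k)) (p.1.take k) *
      (lowerPairs β.length (α.drop k).reverse.length).indicator
        (fun q => zetaWeight β q.1 * zetaWeight (α.drop k).reverse q.2)
        (p.2, (p.1.drop k).reverse) =
      restrictedTerm α β (unimodalLists k k) p := by
  obtain ⟨l, b⟩ := p
  have hlen : l.length = α.length ↔ (l.take k).length = (α.take k).length ∧
      (l.drop k).reverse.length = (α.drop k).reverse.length := by
    simp only [List.length_take, List.length_reverse, List.length_drop]
    omega
  have hrev : (b.take 1 ++ (l.drop k).reverse).IsChain (· ≤ ·) ↔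
      (l.drop k ++ b.take 1).IsChain (· ≥ ·) := by
    have h1 : (b.take 1).reverse = b.take 1 := by obtain _ | ⟨a, b⟩ := b <;> simp
    rw [← h1, ← List.reverse_append, List.isChain_reverse, h1]
  have huni (hl : l.length = α.length) : l ++ b.take 1 ∈ unimodalLists k k ↔
      (l.take k).IsChain (· < ·) ∧ (l.drop k ++ b.take 1).IsChain (· ≥ ·) := by
    rw [← List.take_append_of_le_length (l₂ := b.take 1) (show k ≤ l.length by omega),
      ← List.drop_append_of_le_length (l₂ := b.take 1) (show k ≤ l.length by omega)]
    rfl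
  have hiff : (l.take k ∈ strictLists (α.take k).length ∧
      (b, (l.drop k).reverse) ∈ lowerPairs β.length (α.drop k).reverse.length) ↔
      (l, b) ∈ indexPairs α.length β.length ∧ l ++ b.take 1 ∈ unimodalLists k k := by
    constructor
    · rintro ⟨⟨h1, h2⟩, h3, h4, h5⟩
      have hl := hlen.2 ⟨h1, h4⟩
      exact ⟨⟨hl, h3⟩, (huni hl).2 ⟨h2, hrev.1 h5⟩⟩
    · rintro ⟨⟨hl, h3⟩, h⟩
      obtain ⟨h1, h4⟩ := hlen.1 hl
      obtain ⟨h2, h5⟩ := (huni hl).1 h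
      exact ⟨⟨h1, h2⟩, h3, h4, hrev.2 h5⟩
  have hw (hl : l.length = α.length) : zetaWeight α l = zetaWeight (α.take k) (l.take k) *
      zetaWeight (α.drop k).reverse (l.drop k).reverse := by
    rw [zetaWeight_reverse (by simp [hl]), ← zetaWeight_append (by simp [hl]),
      List.take_append_drop, List.take_append_drop]
  by_cases h : (l, b) ∈ indexPairs α.length β.length ∧ l ++ b.take 1 ∈ unimodalLists k k
  · have h' := hiff.2 h
    rw [restrictedTerm, Set.indicator_of_mem h.1, Set.indicator_of_mem h.2,
      Set.indicator_of_mem h'.1, Set.indicator_of_mem h'.2, hw h.1.1, Pi.one_apply]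
    ring
  · rw [restrictedTerm, indicator_mul_indicator_eq_zero h,
      indicator_mul_indicator_eq_zero (mt hiff.1 h)]

lemma mzv_take_mul_ZL {α β : List ℕ} (hα : ∀ x ∈ α, 2 ≤ x) (hpos : ∀ x ∈ β, 0 < x)
    (hne : β ≠ []) (hlast : 2 ≤ β.getLast hne) {k : ℕ} (hk : k ≤ α.length) :
    Summable (restrictedTerm α β (unimodalLists k k)) ∧
      mzv (α.take k) * ZL β (α.drop k).reverse =
        ∑' p, restrictedTerm α β (unimodalLists k k) p := by
  have hw (γ : List ℕ) : 0 ≤ (strictLists γ.length).indicator (zetaWeight γ) :=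
    fun l => Set.indicator_nonneg (fun l _ => zetaWeight_nonneg _ _) l
  have hf : Summable ((strictLists (α.take k).length).indicator (zetaWeight (α.take k))) := by
    refine (summable_zetaWeight (α := α.take k)
      fun x hx => hα x (List.mem_of_mem_take hx)).of_nonneg_of_le
      (hw _) fun l => ?_
    exact Set.indicator_le_indicator_of_subset (fun l hl => hl.1)
      (fun l => zetaWeight_nonneg _ _) l
  have hg := summable_lowerPairs hpos hne hlast (γ := (α.drop k).reverse)
    fun x hx => hα x (List.mem_of_mem_drop (List.mem_reverse.1 hx))
  have hfg := hf.mul_of_nonneg hg (hw _) fun p => Set.indicator_nonneg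
    (fun p _ => mul_nonneg (zetaWeight_nonneg _ _) (zetaWeight_nonneg _ _)) p
  have hinj : Function.Injective (fun p : List ℕ+ × List ℕ+ =>
      (p.1.take k, (p.2, (p.1.drop k).reverse))) := by
    rintro ⟨l, b⟩ ⟨l', b'⟩ h
    simp only [Prod.mk.injEq, List.reverse_inj] at h
    rw [← List.take_append_drop k l, h.1, h.2.2, List.take_append_drop, h.2.1]
  constructor
  · exact (hfg.comp_injective hinj).congr (restrictedTerm_unimodalLists α β hk)
  · rw [mzv_eq_tsum_list, ZL_eq_tsum_list, tsum_mul_tsum_of_summable_norm hf.norm hg.norm,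
      ← hinj.tsum_eq]
    · exact tsum_congr (restrictedTerm_unimodalLists α β hk)
    · rintro ⟨l, b, l'⟩ h
      have hl := (Set.mem_of_indicator_ne_zero (left_ne_zero_of_mul h)).1
      have hlk : l.length = k := by simpa [hk] using hl
      refine ⟨(l ++ l'.reverse, b), ?_⟩
      simp [← hlk]

lemma mzv_append_eq_tsum (α : List ℕ) {β : List ℕ} (hne : β ≠ []) :
    mzv (α ++ β) = ∑' p, restrictedTerm α β (unimodalLists (α.length + 1) α.length) p := by
  have hinj : Function.Injective (fun l : List ℕ+ => (l.take α.length, l.drop α.length)) := by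
    intro l l' h
    simp only [Prod.mk.injEq] at h
    rw [← List.take_append_drop α.length l, h.1, h.2, List.take_append_drop]
  rw [mzv_eq_tsum_list, ← hinj.tsum_eq]
  · refine tsum_congr fun L => ?_
    have hcat : L.take α.length ++ (L.drop α.length).take 1 = L.take (α.length + 1) :=
      List.take_add.symm
    have huni : L.take (α.length + 1) ∈ unimodalLists (α.length + 1) α.length ↔
        (L.take (α.length + 1)).IsChain (· < ·) := by
      rw [unimodalLists, Set.mem_ofPred_eq, List.take_take, min_self, and_iff_left]
      rw [← hcat, List.drop_append, List.drop_take, Nat.sub_self, List.take_zero, List.nil_append]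
      rcases L.drop α.length with _ | ⟨a, l⟩ <;>
        rcases α.length - (L.take α.length).length with _ | n <;> simp
    have hiff : L ∈ strictLists (α ++ β).length ↔
        (L.take α.length, L.drop α.length) ∈ indexPairs α.length β.length ∧
          L.take (α.length + 1) ∈ unimodalLists (α.length + 1) α.length := by
      have hβ := List.length_pos_iff.2 hne
      rw [huni]
      constructor
      · rintro ⟨h1, h2⟩
        rw [List.length_append] at h1
        exact ⟨⟨by simp [h1], by simp [h1], h2.drop _⟩, h2.take _⟩
      · rintro ⟨⟨h1, h2, h3⟩, h4⟩
        simp only [List.length_take, List.length_drop] at h1 h2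
        refine ⟨by rw [List.length_append]; omega, ?_⟩
        rw [← hcat, List.isChain_append] at h4
        rw [← List.take_append_drop α.length L, List.isChain_append]
        refine ⟨h4.1, h3, fun x hx y hy => h4.2.2 x hx y ?_⟩
        rwa [List.head?_take, if_neg one_ne_zero]
    by_cases h : L ∈ strictLists (α ++ β).length
    · have h' := hiff.1 h
      rw [restrictedTerm, hcat, Set.indicator_of_mem h, Set.indicator_of_mem h'.1,
        Set.indicator_of_mem h'.2, Pi.one_apply, mul_one, ← zetaWeight_append h'.1.1,
        List.take_append_drop]
    · rw [restrictedTerm, hcat, indicator_mul_indicator_eq_zero (mt hiff.2 h),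
        Set.indicator_of_notMem h]
  · rintro ⟨l, b⟩ h
    have hl := (Set.mem_of_indicator_ne_zero (left_ne_zero_of_mul h)).1
    refine ⟨l ++ b, ?_⟩
    dsimp only at hl
    simp [← hl]

/-- Proposition 3.1, Eq. (3.2). -/
theorem stmt_10 (α β : List ℕ)
    (hα : ∀ x ∈ α, 2 ≤ x) (hβpos : ∀ x ∈ β, 0 < x)
    (hβne : β ≠ []) (hβ : 2 ≤ β.getLast hβne) :
    ∑ k ∈ Finset.range (α.length + 1),
      (-1 : ℝ) ^ (α.length - k) * mzv (α.take k) * ZL β ((α.drop k).reverse)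
    = mzv (α ++ β) := by
  have key (k : ℕ) (hk : k ∈ Finset.range (α.length + 1)) :=
    mzv_take_mul_ZL hα hβpos hβne hβ (Nat.lt_succ_iff.1 (Finset.mem_range.1 hk))
  rw [mzv_append_eq_tsum α hβne, Finset.sum_congr rfl fun k hk => by
    rw [mul_assoc, (key k hk).2, ← tsum_mul_left],
    ← Summable.tsum_finsetSum fun k hk => (key k hk).1.mul_left _]
  refine tsum_congr fun p => ?_
  by_cases hp : p ∈ indexPairs α.length β.length
  · have hlen : α.length < (p.1 ++ p.2.take 1).length := by
      have := List.length_pos_iff.2 hβne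
      rw [List.length_append, List.length_take, hp.1, hp.2.1]
      omega
    simp only [restrictedTerm, mul_left_comm _ (Set.indicator (indexPairs _ _) _ _)]
    rw [← Finset.mul_sum, sum_indicator_unimodalLists hlen]
  · simp [restrictedTerm, Set.indicator_of_notMem hp]
end
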